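/- arXiv:1305.5339 — 10 statements merged into one kernel-verified Lean document; each statement's English description precedes it below -/
import Mathlib

section
/- Let X̂ ∈ Φ be a solution minimizing Ĉ(X) = Σ_{e_i∈X} ĉ_i over Φ, where ĉ_i = max_{j∈[K]} c_{ij}. Then for every X ∈ Φ, max_{j∈[K]} F(X̂,c_j) ≤ K · max_{j∈[K]} F(X,c_j); i.e., X̂ is a K-approximate solution to the min-max problem min_{X∈Φ} max_{j∈[K]} F(X,c_j). -/
/-- The solution `Xhat` minimizing the sum of the elementwise maximum
costs `ĉ_i = max_j c i j` is a `K`-approximate solution to the min-max problem: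
for every feasible `X`, `max_j F(Xhat, c_j) ≤ K * max_j F(X, c_j)`. -/
theorem minmax_K_approx {n K : ℕ} (hK : 0 < K)
    (c : Fin n → Fin K → ℝ) (hc : ∀ i j, 0 ≤ c i j)
    (Φ : Set (Finset (Fin n)))
    (Xhat : Finset (Fin n)) (hXhatΦ : Xhat ∈ Φ)
    (hmin : ∀ X ∈ Φ,
      ∑ i ∈ Xhat, (Finset.univ.sup' ⟨⟨0, hK⟩, Finset.mem_univ _⟩ (c i))
        ≤ ∑ i ∈ X, (Finset.univ.sup' ⟨⟨0, hK⟩, Finset.mem_univ _⟩ (c i)))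
    (X : Finset (Fin n)) (hXΦ : X ∈ Φ) :
    Finset.univ.sup' ⟨⟨0, hK⟩, Finset.mem_univ _⟩ (fun j => ∑ i ∈ Xhat, c i j)
      ≤ K * Finset.univ.sup' ⟨⟨0, hK⟩, Finset.mem_univ _⟩ (fun j => ∑ i ∈ X, c i j) := by
  calc
    _ ≤ ∑ i ∈ Xhat, Finset.univ.sup' ⟨⟨0, hK⟩, Finset.mem_univ _⟩ (c i) :=
      Finset.sup'_le _ _ fun j _ =>
        Finset.sum_le_sum fun i _ => Finset.le_sup' (c i) (Finset.mem_univ j)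
    _ ≤ ∑ i ∈ X, Finset.univ.sup' ⟨⟨0, hK⟩, Finset.mem_univ _⟩ (c i) := hmin X hXΦ
    _ ≤ ∑ i ∈ X, ∑ j, c i j :=
      Finset.sum_le_sum fun i _ => Finset.sup'_le _ _ fun j hj =>
        Finset.single_le_sum (f := c i) (fun k _ => hc i k) hj
    _ = ∑ j, ∑ i ∈ X, c i j := Finset.sum_comm
    _ ≤ _ := by
      simpa using Finset.sum_le_card_nsmul Finset.univ (fun j => ∑ i ∈ X, c i j) _
        fun j hj => Finset.le_sup' (fun j => ∑ i ∈ X, c i j) hj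
end

section
/- Let K = 2 with weights (α, 1−α), α ∈ [0,1], so that OWA(X) = α·max{F(X,c_1),F(X,c_2)} + (1−α)·min{F(X,c_1),F(X,c_2)}. Define H_1(X) = max{F(X,c_1), αF(X,c_2)+(1−α)F(X,c_1)} and H_2(X) = max{F(X,c_2), αF(X,c_1)+(1−α)F(X,c_2)}. Then for every X ∈ Φ, OWA(X) = min{H_1(X), H_2(X)}. -/
/-- The Hurwicz combination of two ordered reals as a minimum of two maxima. -/
theorem hurwicz_eq_min_max_of_le {a b α : ℝ} (hα0 : 0 ≤ α) (hα1 : α ≤ 1) (hab : a ≤ b) :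
    α * b + (1 - α) * a
      = min (max a (α * b + (1 - α) * a)) (max b (α * a + (1 - α) * b)) := by
  have h₀ : 0 ≤ α * (b - a) := mul_nonneg hα0 (sub_nonneg.2 hab)
  have h₁ : 0 ≤ (1 - α) * (b - a) := mul_nonneg (sub_nonneg.2 hα1) (sub_nonneg.2 hab)
  rw [max_eq_right (by linarith), max_eq_left (by linarith), min_eq_left (by linarith)]

/-- For `K = 2` and Hurwicz-type weights `(α, 1-α)`, the OWA value
`OWA(X) = α·max{F(X,c₁),F(X,c₂)} + (1-α)·min{F(X,c₁),F(X,c₂)}` equals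
`min{H₁(X), H₂(X)}` where `H₁(X) = max{F(X,c₁), αF(X,c₂)+(1-α)F(X,c₁)}` and
`H₂(X) = max{F(X,c₂), αF(X,c₁)+(1-α)F(X,c₂)}`. -/
theorem owa_eq_min_H1_H2 {n : ℕ}
    (c : Fin n → Fin 2 → ℝ) (hc : ∀ i j, 0 ≤ c i j)
    (α : ℝ) (hα0 : 0 ≤ α) (hα1 : α ≤ 1)
    (Φ : Set (Finset (Fin n)))
    (X : Finset (Fin n)) (hX : X ∈ Φ) :
    α * max (∑ i ∈ X, c i 0) (∑ i ∈ X, c i 1)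
      + (1 - α) * min (∑ i ∈ X, c i 0) (∑ i ∈ X, c i 1)
    = min (max (∑ i ∈ X, c i 0) (α * (∑ i ∈ X, c i 1) + (1 - α) * (∑ i ∈ X, c i 0)))
          (max (∑ i ∈ X, c i 1) (α * (∑ i ∈ X, c i 0) + (1 - α) * (∑ i ∈ X, c i 1))) := by
  rcases le_total (∑ i ∈ X, c i 0) (∑ i ∈ X, c i 1) with h | h
  · rw [max_eq_right h, min_eq_left h]
    exact hurwicz_eq_min_max_of_le hα0 hα1 h
  · rw [max_eq_left h, min_eq_right h, min_comm (max _ _)]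
    exact hurwicz_eq_min_max_of_le hα0 hα1 h
end

section
/- Let K = 2 with weights (α, 1−α) where α ∈ (0, 1/2], so that OWA(X) = α·max{F(X,c_1),F(X,c_2)} + (1−α)·min{F(X,c_1),F(X,c_2)}. Let X_1 ∈ Φ minimize αF(X,c_2)+(1−α)F(X,c_1) over Φ and let X_2 ∈ Φ minimize αF(X,c_1)+(1−α)F(X,c_2) over Φ. Then min{OWA(X_1), OWA(X_2)} = min_{X∈Φ} OWA(X); i.e., either X_1 or X_2 is an optimal solution to Min-OWA. -/
/-- For a weight `α ≤ 1 / 2`, the ordered weighted average of two reals is the smaller of the two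
weighted averages with weights `α` and `1 - α`. -/
theorem mul_max_add_mul_min_eq_min {α : ℝ} (hα : α ≤ 1 / 2) (a b : ℝ) :
    α * max a b + (1 - α) * min a b = min (α * b + (1 - α) * a) (α * a + (1 - α) * b) := by
  rcases le_total a b with h | h
  · rw [max_eq_right h, min_eq_left h, min_eq_left (by nlinarith)]
  · rw [max_eq_left h, min_eq_right h, min_eq_right (by nlinarith)]


/-- For `K = 2` and weights `(α, 1-α)` with `α ∈ (0, 1/2]`, if `X₁`
minimizes `αF(X,c₂)+(1-α)F(X,c₁)` over `Φ` and `X₂` minimizes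
`αF(X,c₁)+(1-α)F(X,c₂)` over `Φ`, then `min{OWA(X₁), OWA(X₂)}` equals
`min_{X∈Φ} OWA(X)`, where `OWA(X) = α·max{F(X,c₁),F(X,c₂)} + (1-α)·min{F(X,c₁),F(X,c₂)}`;
i.e., either `X₁` or `X₂` is optimal for Min-OWA. -/
theorem minowa_two_scenarios_opt {n : ℕ}
    (c : Fin n → Fin 2 → ℝ) (hc : ∀ i j, 0 ≤ c i j)
    (α : ℝ) (hα0 : 0 < α) (hα : α ≤ 1 / 2)
    (Φ : Set (Finset (Fin n)))
    (X1 : Finset (Fin n)) (hX1 : X1 ∈ Φ)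
    (hX1min : ∀ X ∈ Φ,
      α * (∑ i ∈ X1, c i 1) + (1 - α) * (∑ i ∈ X1, c i 0)
        ≤ α * (∑ i ∈ X, c i 1) + (1 - α) * (∑ i ∈ X, c i 0))
    (X2 : Finset (Fin n)) (hX2 : X2 ∈ Φ)
    (hX2min : ∀ X ∈ Φ,
      α * (∑ i ∈ X2, c i 0) + (1 - α) * (∑ i ∈ X2, c i 1)
        ≤ α * (∑ i ∈ X, c i 0) + (1 - α) * (∑ i ∈ X, c i 1)) :
    IsLeast {v : ℝ | ∃ X ∈ Φ,
        v = α * max (∑ i ∈ X, c i 0) (∑ i ∈ X, c i 1)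
              + (1 - α) * min (∑ i ∈ X, c i 0) (∑ i ∈ X, c i 1)}
      (min (α * max (∑ i ∈ X1, c i 0) (∑ i ∈ X1, c i 1)
              + (1 - α) * min (∑ i ∈ X1, c i 0) (∑ i ∈ X1, c i 1))
           (α * max (∑ i ∈ X2, c i 0) (∑ i ∈ X2, c i 1)
              + (1 - α) * min (∑ i ∈ X2, c i 0) (∑ i ∈ X2, c i 1))) := by
  simp only [mul_max_add_mul_min_eq_min hα]
  constructor
  · rcases min_choice
      (min (α * (∑ i ∈ X1, c i 1) + (1 - α) * (∑ i ∈ X1, c i 0))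
        (α * (∑ i ∈ X1, c i 0) + (1 - α) * (∑ i ∈ X1, c i 1)))
      (min (α * (∑ i ∈ X2, c i 1) + (1 - α) * (∑ i ∈ X2, c i 0))
        (α * (∑ i ∈ X2, c i 0) + (1 - α) * (∑ i ∈ X2, c i 1))) with h | h
    · exact ⟨X1, hX1, h⟩
    · exact ⟨X2, hX2, h⟩
  · rintro _ ⟨X, hX, rfl⟩
    exact min_le_min ((min_le_left _ _).trans (hX1min X hX))
      ((min_le_right _ _).trans (hX2min X hX))
end

section
/- Suppose the weights are nonincreasing, i.e. w_1 ≥ w_2 ≥ … ≥ w_K. For each element e_i let ĉ_{i1} ≥ ĉ_{i2} ≥ … ≥ ĉ_{iK} be the costs c_{i1},…,c_{iK} sorted in nonincreasing order, let ĉ_i = Σ_{j∈[K]} w_j ĉ_{ij}, and let X̂ ∈ Φ minimize Ĉ(X) = Σ_{e_i∈X} ĉ_i over Φ. Then for every X ∈ Φ, OWA(X̂) ≤ w_1·K·OWA(X). -/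
/-- For nonincreasing weights `w 0 ≥ w 1 ≥ … ≥ w (K-1)` summing to 1,
let `ĉ_i = ∑ j, w j * c i (π i j)` where `π i` sorts the costs of element `i`
nonincreasingly, and let `Xhat ∈ Φ` minimize `Ĉ(X) = ∑_{i∈X} ĉ_i` over `Φ`.
Then for every `X ∈ Φ`, `OWA(Xhat) ≤ w ⟨0, hK⟩ * K * OWA(X)`, where `OWA` is computed
with sorting permutations `σ` (for `Xhat`) and `ρ` (for `X`) of the scenario costs. -/
theorem owa_nonincreasing_approx {n K : ℕ} (hK : 0 < K)
    (c : Fin n → Fin K → ℝ) (hc : ∀ i j, 0 ≤ c i j)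
    (w : Fin K → ℝ) (hw0 : ∀ j, 0 ≤ w j) (hw1 : ∀ j, w j ≤ 1)
    (hwsum : ∑ j, w j = 1)
    (hwmono : ∀ j k : Fin K, j ≤ k → w k ≤ w j)
    (π : Fin n → Equiv.Perm (Fin K))
    (hπ : ∀ i, ∀ j k : Fin K, j ≤ k → c i (π i k) ≤ c i (π i j))
    (Φ : Set (Finset (Fin n)))
    (Xhat : Finset (Fin n)) (hXhatΦ : Xhat ∈ Φ)
    (hmin : ∀ X ∈ Φ,
      ∑ i ∈ Xhat, ∑ j, w j * c i (π i j) ≤ ∑ i ∈ X, ∑ j, w j * c i (π i j))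
    (X : Finset (Fin n)) (hXΦ : X ∈ Φ)
    (σ : Equiv.Perm (Fin K))
    (hσ : ∀ j k : Fin K, j ≤ k → ∑ i ∈ Xhat, c i (σ k) ≤ ∑ i ∈ Xhat, c i (σ j))
    (ρ : Equiv.Perm (Fin K))
    (hρ : ∀ j k : Fin K, j ≤ k → ∑ i ∈ X, c i (ρ k) ≤ ∑ i ∈ X, c i (ρ j)) :
    ∑ j, w j * ∑ i ∈ Xhat, c i (σ j) ≤ w ⟨0, hK⟩ * K * ∑ j, w j * ∑ i ∈ X, c i (ρ j) := by
  have hwanti : Antitone w := fun j k h ↦ hwmono j k h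
  have hrearr (i : Fin n) : ∑ j, w j * c i (σ j) ≤ ∑ j, w j * c i (π i j) := by
    have hmono : Monovary w (fun j ↦ c i (π i j)) :=
      hwanti.monovary fun j k h ↦ hπ i j k h
    simpa using hmono.sum_mul_comp_perm_le_sum_mul (σ := σ.trans (π i).symm)
  have hbound (i : Fin n) : ∑ j, w j * c i (π i j) ≤ w ⟨0, hK⟩ * ∑ j, c i (ρ j) := by
    rw [Equiv.sum_comp ρ (c i), ← Equiv.sum_comp (π i) (c i), Finset.mul_sum]
    exact Finset.sum_le_sum fun j _ ↦
      mul_le_mul_of_nonneg_right (hwmono _ _ (Nat.zero_le _)) (hc _ _)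
  have hcheb : ∑ j, ∑ i ∈ X, c i (ρ j) ≤ K * ∑ j, w j * ∑ i ∈ X, c i (ρ j) := by
    have hmono : Monovary w (fun j ↦ ∑ i ∈ X, c i (ρ j)) :=
      hwanti.monovary fun j k h ↦ hρ j k h
    simpa [hwsum] using hmono.sum_mul_sum_le_card_mul_sum
  calc ∑ j, w j * ∑ i ∈ Xhat, c i (σ j)
      = ∑ i ∈ Xhat, ∑ j, w j * c i (σ j) := by
        simp_rw [Finset.mul_sum]
        exact Finset.sum_comm
    _ ≤ ∑ i ∈ Xhat, ∑ j, w j * c i (π i j) := Finset.sum_le_sum fun i _ ↦ hrearr i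
    _ ≤ ∑ i ∈ X, ∑ j, w j * c i (π i j) := hmin X hXΦ
    _ ≤ ∑ i ∈ X, w ⟨0, hK⟩ * ∑ j, c i (ρ j) := Finset.sum_le_sum fun i _ ↦ hbound i
    _ = w ⟨0, hK⟩ * ∑ j, ∑ i ∈ X, c i (ρ j) := by
        rw [← Finset.mul_sum, Finset.sum_comm]
    _ ≤ w ⟨0, hK⟩ * (K * ∑ j, w j * ∑ i ∈ X, c i (ρ j)) :=
        mul_le_mul_of_nonneg_left hcheb (hw0 _)
    _ = w ⟨0, hK⟩ * K * ∑ j, w j * ∑ i ∈ X, c i (ρ j) := (mul_assoc _ _ _).symm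
end

section
/- The bound OWA(X̂) ≤ w_1·K·OWA(X) for nonincreasing weights is tight: for any K ≥ 1 and any nonincreasing weights w_1 ≥ … ≥ w_K summing to 1, consider the instance with E = {e_1,…,e_{2K}}, Φ = {X ⊆ E : |X| = K}, and costs c_{ij} where for m ∈ [K] element e_m has cost 1 under scenario K and cost 0 under all other scenarios, and for m ∈ [K] element e_{K+m} has cost 1 under scenario m and cost 0 under all other scenarios. Then every element has the same aggregated cost ĉ_i = w_1, the solution X̂ = {e_1,…,e_K} satisfies OWA(X̂) = w_1·K, and the solution X = {e_{K+1},…,e_{2K}} satisfies OWA(X) = 1. -/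
/-- Sorting a nonnegative multiple `v` of an indicator in nonincreasing order puts `v` first, so
its ordered weighted aggregate is `w 0 * v`. -/
theorem sum_mul_single_of_sorted {K : ℕ} (hK : 0 < K) (w f : Fin K → ℝ) (a : Fin K) (v : ℝ)
    (hv : 0 < v) (hf : ∀ j, f j = if j = a then v else 0) (π : Equiv.Perm (Fin K))
    (hπ : ∀ j k : Fin K, j ≤ k → f (π k) ≤ f (π j)) :
    ∑ j, w j * f (π j) = w ⟨0, hK⟩ * v := by
  have hfirst : π ⟨0, hK⟩ = a := by
    by_contra hne
    have h := hπ ⟨0, hK⟩ (π.symm a) (Fin.mk_le_of_le_val (Nat.zero_le _))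
    rw [Equiv.apply_symm_apply, hf, hf, if_pos rfl, if_neg hne] at h
    linarith
  have hiff : ∀ j, π j = a ↔ j = ⟨0, hK⟩ := fun j => by
    rw [← hfirst, π.injective.eq_iff]
  simp [hf, hiff]


/-- Tightness of the `w₁K` bound for nonincreasing weights. On the
instance with `2K` elements where for `m < K` element `m` has cost 1 under
scenario `K-1` and 0 otherwise, and element `K+m` has cost 1 under scenario `m`
and 0 otherwise: every element has aggregated cost `ĉ_i = w 0`; the solution
`Xhat = {e_1,…,e_K}` (elements `m < K`) has `OWA(Xhat) = w 0 * K`; and the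
solution `X = {e_{K+1},…,e_{2K}}` (elements `m ≥ K`) has `OWA(X) = 1`. -/
theorem owa_nonincreasing_bound_tight {K : ℕ} (hK : 0 < K)
    (w : Fin K → ℝ) (hw0 : ∀ j, 0 ≤ w j) (hw1 : ∀ j, w j ≤ 1)
    (hwsum : ∑ j, w j = 1)
    (hwmono : ∀ j k : Fin K, j ≤ k → w k ≤ w j)
    (c : Fin (2 * K) → Fin K → ℝ)
    (hcdef : ∀ (m : Fin (2 * K)) (j : Fin K),
      c m j = if (m : ℕ) < K then (if (j : ℕ) = K - 1 then 1 else 0)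
              else (if (j : ℕ) = (m : ℕ) - K then 1 else 0)) :
    (∀ (m : Fin (2 * K)) (π : Equiv.Perm (Fin K)),
        (∀ j k : Fin K, j ≤ k → c m (π k) ≤ c m (π j)) →
        ∑ j, w j * c m (π j) = w ⟨0, hK⟩)
    ∧ (∀ σ : Equiv.Perm (Fin K),
        (∀ j k : Fin K, j ≤ k →
          ∑ m ∈ Finset.univ.filter (fun m : Fin (2 * K) => (m : ℕ) < K), c m (σ k)
            ≤ ∑ m ∈ Finset.univ.filter (fun m : Fin (2 * K) => (m : ℕ) < K), c m (σ j)) →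
        ∑ j, w j * ∑ m ∈ Finset.univ.filter (fun m : Fin (2 * K) => (m : ℕ) < K), c m (σ j)
          = w ⟨0, hK⟩ * K)
    ∧ (∀ ρ : Equiv.Perm (Fin K),
        (∀ j k : Fin K, j ≤ k →
          ∑ m ∈ Finset.univ.filter (fun m : Fin (2 * K) => K ≤ (m : ℕ)), c m (ρ k)
            ≤ ∑ m ∈ Finset.univ.filter (fun m : Fin (2 * K) => K ≤ (m : ℕ)), c m (ρ j)) →
        ∑ j, w j * ∑ m ∈ Finset.univ.filter (fun m : Fin (2 * K) => K ≤ (m : ℕ)), c m (ρ j)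
          = 1) := by
  have hsum_lt : ∀ j : Fin K,
      ∑ m ∈ Finset.univ.filter (fun m : Fin (2 * K) => (m : ℕ) < K), c m j
        = if j = ⟨K - 1, by omega⟩ then (K : ℝ) else 0 := by
    intro j
    have hc : ∀ m ∈ Finset.univ.filter (fun m : Fin (2 * K) => (m : ℕ) < K),
        c m j = if j = ⟨K - 1, by omega⟩ then (1 : ℝ) else 0 := by
      intro m hm
      rw [hcdef, if_pos (Finset.mem_filter.mp hm).2]
      simp only [Fin.ext_iff]
    rw [Finset.sum_congr rfl hc, Finset.sum_const, Fin.card_filter_val_lt,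
      min_eq_right (by omega)]
    simp
  have hsum_ge : ∀ j : Fin K,
      ∑ m ∈ Finset.univ.filter (fun m : Fin (2 * K) => K ≤ (m : ℕ)), c m j = 1 := by
    intro j
    rw [Finset.sum_eq_single (⟨K + j, by omega⟩ : Fin (2 * K))]
    · simp [hcdef]
    · intro m hm hne
      have hm' := (Finset.mem_filter.mp hm).2
      rw [hcdef, if_neg (by omega), if_neg]
      intro h
      exact hne (Fin.ext (by simp only; omega))
    · simp
  refine ⟨fun m π hπ => ?_, fun σ hσ => ?_, fun ρ _ => ?_⟩
  · obtain ⟨a, ha⟩ : ∃ a : Fin K, ∀ j, c m j = if j = a then (1 : ℝ) else 0 := by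
      by_cases hm : (m : ℕ) < K
      · exact ⟨⟨K - 1, by omega⟩, fun j => by simp [hcdef, hm, Fin.ext_iff]⟩
      · exact ⟨⟨m - K, by omega⟩, fun j => by simp [hcdef, hm, Fin.ext_iff]⟩
    simpa using sum_mul_single_of_sorted hK w (c m) a 1 one_pos ha π hπ
  · exact sum_mul_single_of_sorted hK w _ _ K (Nat.cast_pos.mpr hK) hsum_lt σ hσ
  · simp [hsum_ge, hwsum]
end

section
/- Suppose the weights are nonincreasing, i.e. w_1 ≥ w_2 ≥ … ≥ w_K. For each element e_i let ĉ_{i1} ≥ … ≥ ĉ_{iK} be the costs c_{i1},…,c_{iK} sorted in nonincreasing order and let ĉ_i = Σ_{j∈[K]} w_j ĉ_{ij}. Then for every X ∈ Φ, OWA(X) ≤ Ĉ(X) = Σ_{e_i∈X} ĉ_i. (Aggregating each element's costs by OWA before summing over the solution overestimates the OWA of the solution's scenario costs when the weights are nonincreasing.) -/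
/-- For nonincreasing weights, the OWA of a solution's scenario
costs is at most the sum over the solution's elements of their OWA-aggregated
costs: `OWA(X) ≤ Ĉ(X) = ∑_{i∈X} ĉ_i` where `ĉ_i = ∑ j, w j * c i (π i j)` with
`π i` sorting the costs of element `i` nonincreasingly and `σ` sorting the
scenario costs of `X` nonincreasingly. -/
theorem owa_le_aggregated_cost {n K : ℕ}
    (c : Fin n → Fin K → ℝ) (hc : ∀ i j, 0 ≤ c i j)
    (w : Fin K → ℝ) (hw0 : ∀ j, 0 ≤ w j) (hw1 : ∀ j, w j ≤ 1)
    (hwsum : ∑ j, w j = 1)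
    (hwmono : ∀ j k : Fin K, j ≤ k → w k ≤ w j)
    (π : Fin n → Equiv.Perm (Fin K))
    (hπ : ∀ i, ∀ j k : Fin K, j ≤ k → c i (π i k) ≤ c i (π i j))
    (Φ : Set (Finset (Fin n)))
    (X : Finset (Fin n)) (hXΦ : X ∈ Φ)
    (σ : Equiv.Perm (Fin K))
    (hσ : ∀ j k : Fin K, j ≤ k → ∑ i ∈ X, c i (σ k) ≤ ∑ i ∈ X, c i (σ j)) :
    ∑ j, w j * ∑ i ∈ X, c i (σ j) ≤ ∑ i ∈ X, ∑ j, w j * c i (π i j) := by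
  simp_rw [Finset.mul_sum]
  rw [Finset.sum_comm]
  refine Finset.sum_le_sum fun i _ ↦ ?_
  have hmono : Monovary w (fun j ↦ c i (π i j)) :=
    Antitone.monovary (fun j k h ↦ hwmono j k h) (fun j k h ↦ hπ i j k h)
  simpa using hmono.sum_mul_comp_perm_le_sum_mul (σ := σ.trans (π i).symm)
end

section
/- Suppose the weights are nonincreasing, i.e. w_1 ≥ w_2 ≥ … ≥ w_K, let ĉ_i = Σ_{j∈[K]} w_j ĉ_{ij} where ĉ_{i1} ≥ … ≥ ĉ_{iK} are the sorted costs of e_i, and let Ĉ(X) = Σ_{e_i∈X} ĉ_i. Let γ ≥ 1 and let X̂ ∈ Φ be a γ-approximate minimizer of Ĉ, i.e. Ĉ(X̂) ≤ γ·min_{X∈Φ} Ĉ(X). Then for every X ∈ Φ, OWA(X̂) ≤ w_1·γ·K·OWA(X). -/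
/-- For nonincreasing weights, if `Xhat ∈ Φ` is a `γ`-approximate
minimizer of the aggregated cost `Ĉ(X) = ∑_{i∈X} ĉ_i` (with
`ĉ_i = ∑ j, w j * c i (π i j)`, `π i` sorting element `i`'s costs
nonincreasingly), then for every `X ∈ Φ`, `OWA(Xhat) ≤ w 0 * γ * K * OWA(X)`. -/
theorem owa_nonincreasing_gamma_approx {n K : ℕ} (hK : 0 < K)
    (c : Fin n → Fin K → ℝ) (hc : ∀ i j, 0 ≤ c i j)
    (w : Fin K → ℝ) (hw0 : ∀ j, 0 ≤ w j) (hw1 : ∀ j, w j ≤ 1)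
    (hwsum : ∑ j, w j = 1)
    (hwmono : ∀ j k : Fin K, j ≤ k → w k ≤ w j)
    (π : Fin n → Equiv.Perm (Fin K))
    (hπ : ∀ i, ∀ j k : Fin K, j ≤ k → c i (π i k) ≤ c i (π i j))
    (γ : ℝ) (hγ : 1 ≤ γ)
    (Φ : Set (Finset (Fin n)))
    (Xhat : Finset (Fin n)) (hXhatΦ : Xhat ∈ Φ)
    (happrox : ∀ X ∈ Φ,
      ∑ i ∈ Xhat, ∑ j, w j * c i (π i j) ≤ γ * ∑ i ∈ X, ∑ j, w j * c i (π i j))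
    (X : Finset (Fin n)) (hXΦ : X ∈ Φ)
    (σ : Equiv.Perm (Fin K))
    (hσ : ∀ j k : Fin K, j ≤ k → ∑ i ∈ Xhat, c i (σ k) ≤ ∑ i ∈ Xhat, c i (σ j))
    (ρ : Equiv.Perm (Fin K))
    (hρ : ∀ j k : Fin K, j ≤ k → ∑ i ∈ X, c i (ρ k) ≤ ∑ i ∈ X, c i (ρ j)) :
    ∑ j, w j * ∑ i ∈ Xhat, c i (σ j)
      ≤ w ⟨0, hK⟩ * γ * K * ∑ j, w j * ∑ i ∈ X, c i (ρ j) := by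
  have monovary_of_le {f g : Fin K → ℝ} (hf : ∀ j k : Fin K, j ≤ k → f k ≤ f j)
      (hg : ∀ j k : Fin K, j ≤ k → g k ≤ g j) : Monovary f g :=
    Antitone.monovary (fun j k h => hf j k h) (fun j k h => hg j k h)
  have owa_le_aggregated : ∑ j, w j * ∑ i ∈ Xhat, c i (σ j)
      ≤ ∑ i ∈ Xhat, ∑ j, w j * c i (π i j) := by
    simp_rw [Finset.mul_sum]
    rw [Finset.sum_comm]
    refine Finset.sum_le_sum fun i _ => ?_
    simpa using (monovary_of_le hwmono (hπ i)).sum_mul_comp_perm_le_sum_mul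
      (σ := σ.trans (π i).symm)
  have aggregated_le_total : ∑ i ∈ X, ∑ j, w j * c i (π i j)
      ≤ w ⟨0, hK⟩ * ∑ j, ∑ i ∈ X, c i (ρ j) := by
    rw [Finset.sum_comm (s := Finset.univ), Finset.mul_sum]
    refine Finset.sum_le_sum fun i _ => ?_
    rw [Equiv.sum_comp ρ (c i), ← Equiv.sum_comp (π i) (c i), Finset.mul_sum]
    exact Finset.sum_le_sum fun j _ =>
      mul_le_mul_of_nonneg_right (hwmono _ _ (Nat.zero_le j)) (hc _ _)
  have total_le_owa : ∑ j, ∑ i ∈ X, c i (ρ j) ≤ K * ∑ j, w j * ∑ i ∈ X, c i (ρ j) := by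
    simpa [hwsum] using (monovary_of_le hwmono hρ).sum_mul_sum_le_card_mul_sum
  have hγ0 : 0 ≤ γ := zero_le_one.trans hγ
  calc ∑ j, w j * ∑ i ∈ Xhat, c i (σ j)
      ≤ ∑ i ∈ Xhat, ∑ j, w j * c i (π i j) := owa_le_aggregated
    _ ≤ γ * ∑ i ∈ X, ∑ j, w j * c i (π i j) := happrox X hXΦ
    _ ≤ γ * (w ⟨0, hK⟩ * (K * ∑ j, w j * ∑ i ∈ X, c i (ρ j))) :=
        mul_le_mul_of_nonneg_left (aggregated_le_total.trans
          (mul_le_mul_of_nonneg_left total_le_owa (hw0 _))) hγ0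
    _ = _ := by ring
end

section
/- Let K ≥ 2, let α ∈ [1/2, 1], and use the Hurwicz criterion OWA(X) = α·max_{j∈[K]} F(X,c_j) + (1−α)·min_{j∈[K]} F(X,c_j). For each element e_i let ĉ_{i1} ≥ ĉ_{i2} be its two largest costs among c_{i1},…,c_{iK}, set ĉ_i = α·ĉ_{i1} + (1−α)·ĉ_{i2}, and let X̂ ∈ Φ minimize Ĉ(X) = Σ_{e_i∈X} ĉ_i over Φ. Then for every X ∈ Φ, OWA(X̂) ≤ [αK + (1−α)(K−2)]·OWA(X). -/
/-- A weighted sum of two distinct entries of a family, with the larger weight on the first one,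
is at most the same weighted sum of the two largest entries. -/
theorem weighted_pair_le_sorted {K : ℕ} (f : Fin K → ℝ) (σ : Equiv.Perm (Fin K))
    (hσ : ∀ j k : Fin K, j ≤ k → f (σ k) ≤ f (σ j)) {α : ℝ} (hα0 : 1 / 2 ≤ α) (hα1 : α ≤ 1)
    {p q : Fin K} (hp : (p : ℕ) = 0) (hq : (q : ℕ) = 1)
    {u v : Fin K} (huv : u ≠ v) :
    α * f u + (1 - α) * f v ≤ α * f (σ p) + (1 - α) * f (σ q) := by
  obtain ⟨a, rfl⟩ := σ.surjective u
  obtain ⟨b, rfl⟩ := σ.surjective v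
  have ha := hσ p a (Fin.le_def.2 (by omega))
  have hb := hσ p b (Fin.le_def.2 (by omega))
  have h01 := hσ p q (Fin.le_def.2 (by omega))
  have hab : (a : ℕ) ≠ b := fun h => huv (congrArg σ (Fin.ext h))
  rcases Nat.eq_zero_or_pos (b : ℕ) with h | h
  · have ha1 := hσ q a (Fin.le_def.2 (by omega))
    nlinarith
  · have hb1 := hσ q b (Fin.le_def.2 (by omega))
    nlinarith

/-- A weighted sum of two distinct entries of a nonnegative family, with the larger weight on the
first one, is at most that weight times the total. -/
theorem weighted_pair_le_mul_sum {ι : Type*} [Fintype ι] (f : ι → ℝ) (hf : ∀ j, 0 ≤ f j)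
    {α : ℝ} (hα : 1 / 2 ≤ α) {u v : ι} (huv : u ≠ v) :
    α * f u + (1 - α) * f v ≤ α * ∑ j, f j := by
  classical
  have h : ∑ j ∈ {u, v}, f j ≤ ∑ j, f j :=
    Finset.sum_le_sum_of_subset_of_nonneg (Finset.subset_univ _) fun j _ _ => hf j
  rw [Finset.sum_pair huv] at h
  nlinarith [hf v]

/-- A sum with one distinguished term is bounded by that term plus a bound on all the others. -/
theorem sum_le_card_sub_one_mul_add {ι : Type*} [Fintype ι] (g : ι → ℝ) {M : ℝ}
    (hM : ∀ j, g j ≤ M) (v : ι) :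
    ∑ j, g j ≤ ((Fintype.card ι : ℝ) - 1) * M + g v := by
  classical
  have h := Finset.sum_le_card_nsmul (Finset.univ.erase v) g M fun j _ => hM j
  rw [Finset.card_erase_of_mem (Finset.mem_univ v), Finset.card_univ, nsmul_eq_mul,
    Nat.cast_sub (Fintype.card_pos_iff.2 ⟨v⟩), Nat.cast_one] at h
  rw [← Finset.sum_erase_add _ _ (Finset.mem_univ v)]
  linarith


/-- Approximation for Min-Hurwicz with `α ∈ [1/2,1]` and `K ≥ 2`.
For each element `i`, `π i` sorts its costs nonincreasingly, so `c i (π i 0)` and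
`c i (π i 1)` are its two largest costs; `ĉ_i = α·c i (π i 0) + (1-α)·c i (π i 1)`.
If `Xhat ∈ Φ` minimizes `Ĉ(X) = ∑_{i∈X} ĉ_i` over `Φ`, then for every `X ∈ Φ`,
`OWA(Xhat) ≤ (αK + (1-α)(K-2))·OWA(X)`, where
`OWA(Y) = α·max_j F(Y,c_j) + (1-α)·min_j F(Y,c_j)` is the Hurwicz criterion. -/
theorem hurwicz_approx {n K : ℕ} (hK : 2 ≤ K)
    (c : Fin n → Fin K → ℝ) (hc : ∀ i j, 0 ≤ c i j)
    (α : ℝ) (hα0 : 1 / 2 ≤ α) (hα1 : α ≤ 1)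
    (π : Fin n → Equiv.Perm (Fin K))
    (hπ : ∀ i, ∀ j k : Fin K, j ≤ k → c i (π i k) ≤ c i (π i j))
    (Φ : Set (Finset (Fin n)))
    (Xhat : Finset (Fin n)) (hXhatΦ : Xhat ∈ Φ)
    (hmin : ∀ X ∈ Φ,
      ∑ i ∈ Xhat, (α * c i (π i ⟨0, by omega⟩) + (1 - α) * c i (π i ⟨1, by omega⟩))
        ≤ ∑ i ∈ X, (α * c i (π i ⟨0, by omega⟩) + (1 - α) * c i (π i ⟨1, by omega⟩)))
    (X : Finset (Fin n)) (hXΦ : X ∈ Φ) :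
    α * Finset.univ.sup' ⟨⟨0, by omega⟩, Finset.mem_univ _⟩ (fun j => ∑ i ∈ Xhat, c i j)
      + (1 - α) * Finset.univ.inf' ⟨⟨0, by omega⟩, Finset.mem_univ _⟩ (fun j => ∑ i ∈ Xhat, c i j)
    ≤ (α * K + (1 - α) * ((K : ℝ) - 2)) *
      (α * Finset.univ.sup' ⟨⟨0, by omega⟩, Finset.mem_univ _⟩ (fun j => ∑ i ∈ X, c i j)
        + (1 - α) * Finset.univ.inf' ⟨⟨0, by omega⟩, Finset.mem_univ _⟩ (fun j => ∑ i ∈ X, c i j)) := by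
  have : Nontrivial (Fin K) := Fin.nontrivial_iff_two_le.2 hK
  have hupper : α * Finset.univ.sup' ⟨⟨0, by omega⟩, Finset.mem_univ _⟩
        (fun j => ∑ i ∈ Xhat, c i j)
      + (1 - α) * Finset.univ.inf' ⟨⟨0, by omega⟩, Finset.mem_univ _⟩
        (fun j => ∑ i ∈ Xhat, c i j)
      ≤ ∑ i ∈ Xhat, (α * c i (π i ⟨0, by omega⟩) + (1 - α) * c i (π i ⟨1, by omega⟩)) := by
    obtain ⟨u, -, hu⟩ := Finset.exists_mem_eq_sup' (s := Finset.univ)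
      ⟨⟨0, by omega⟩, Finset.mem_univ _⟩ (fun j : Fin K => ∑ i ∈ Xhat, c i j)
    obtain ⟨v, hv⟩ := exists_ne u
    have hle := Finset.inf'_le (fun j : Fin K => ∑ i ∈ Xhat, c i j) (Finset.mem_univ v)
    rw [hu]
    calc _ ≤ α * ∑ i ∈ Xhat, c i u + (1 - α) * ∑ i ∈ Xhat, c i v := by
          gcongr
      _ = ∑ i ∈ Xhat, (α * c i u + (1 - α) * c i v) := by
          rw [Finset.sum_add_distrib, Finset.mul_sum, Finset.mul_sum]
      _ ≤ _ := Finset.sum_le_sum fun i _ =>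
          weighted_pair_le_sorted (c i) (π i) (hπ i) hα0 hα1 rfl rfl hv.symm
  refine (hupper.trans (hmin X hXΦ)).trans ?_
  obtain ⟨v, -, hv⟩ := Finset.exists_mem_eq_inf' (s := Finset.univ)
    ⟨⟨0, by omega⟩, Finset.mem_univ _⟩ (fun j : Fin K => ∑ i ∈ X, c i j)
  have hM : ∀ j, ∑ i ∈ X, c i j ≤ Finset.univ.sup' ⟨⟨0, by omega⟩, Finset.mem_univ _⟩
      (fun j => ∑ i ∈ X, c i j) :=
    fun j => Finset.le_sup' (fun j => ∑ i ∈ X, c i j) (Finset.mem_univ j)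
  rw [hv]
  generalize Finset.univ.sup' ⟨⟨0, by omega⟩, Finset.mem_univ _⟩
    (fun j => ∑ i ∈ X, c i j) = M at hM ⊢
  have hm0 : 0 ≤ ∑ i ∈ X, c i v := Finset.sum_nonneg fun i _ => hc i v
  have hsum := sum_le_card_sub_one_mul_add _ hM v
  rw [Fintype.card_fin] at hsum
  have hK' : (2 : ℝ) ≤ K := by exact_mod_cast hK
  calc _ ≤ ∑ i ∈ X, α * ∑ j, c i j := Finset.sum_le_sum fun i _ =>
        weighted_pair_le_mul_sum (c i) (hc i) hα0 ((π i).injective.ne (by simp))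
    _ = α * ∑ j, ∑ i ∈ X, c i j := by rw [← Finset.mul_sum, Finset.sum_comm]
    _ ≤ α * (((K : ℝ) - 1) * M + ∑ i ∈ X, c i v) := by gcongr
    _ ≤ _ := by
        have h1 : 0 ≤ α * (2 * α - 1) * (M - ∑ i ∈ X, c i v) :=
          mul_nonneg (mul_nonneg (by linarith) (by linarith)) (sub_nonneg.2 (hM v))
        have h2 : 0 ≤ (K - 2) * (1 - α) * ∑ i ∈ X, c i v :=
          mul_nonneg (mul_nonneg (by linarith) (by linarith)) hm0
        linear_combination h1 + h2
end

section
/- Let K ≥ 2, α ∈ [1/2, 1], and let a ≥ b ≥ 0 be reals. Then α·a + (1−α)·b ≥ [(K−1)·a + b] / [K + ((1−α)/α)·(K−2)]. (Applied with a = max_{j∈[K]} F(X,c_j) and b = min_{j∈[K]} F(X,c_j), and using Σ_{j∈[K]} F(X,c_j) ≤ (K−1)a + b, this yields OWA(X) ≥ Σ_{e_i∈X} Σ_{j∈[K]} c_{ij} / [K + ((1−α)/α)(K−2)] for the Hurwicz criterion.) -/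
/-- The key lower bound in the Min-Hurwicz approximation proof.
For `K ≥ 2`, `α ∈ [1/2,1]` and reals `a ≥ b ≥ 0`,
`α·a + (1-α)·b ≥ ((K-1)·a + b) / (K + ((1-α)/α)·(K-2))`. -/
theorem hurwicz_lower_bound (K : ℕ) (hK : 2 ≤ K)
    (α a b : ℝ) (hα0 : 1 / 2 ≤ α) (hα1 : α ≤ 1)
    (hb : 0 ≤ b) (hab : b ≤ a) :
    (((K : ℝ) - 1) * a + b) / ((K : ℝ) + ((1 - α) / α) * ((K : ℝ) - 2))
      ≤ α * a + (1 - α) * b := by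
  have hK' : (0 : ℝ) ≤ (K : ℝ) - 2 := by
    have : (2 : ℝ) ≤ K := by exact_mod_cast hK
    linarith
  have hα : 0 < α := by linarith
  have hden : (K : ℝ) + ((1 - α) / α) * ((K : ℝ) - 2) = ((K : ℝ) - 2 + 2 * α) / α := by
    field_simp
    ring
  rw [hden, div_div_eq_mul_div, div_le_iff₀ (by linarith)]
  have h₁ : 0 ≤ α * (2 * α - 1) * (a - b) :=
    mul_nonneg (mul_nonneg hα.le (by linarith)) (by linarith)
  have h₂ : 0 ≤ (1 - α) * ((K : ℝ) - 2) * b :=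
    mul_nonneg (mul_nonneg (by linarith) hK') hb
  linarith
end

section
/- Use the Hurwicz criterion OWA(X) = α·max_{j∈[K]} F(X,c_j) + (1−α)·min_{j∈[K]} F(X,c_j) with α ∈ (0,1]. Let γ ≥ 1 and let X̂ ∈ Φ satisfy max_{j∈[K]} F(X̂,c_j) ≤ γ·min_{X∈Φ} max_{j∈[K]} F(X,c_j) (i.e., X̂ is a γ-approximate min-max solution). Then for every X ∈ Φ: (i) if α = 1 or min_{j∈[K]} F(X̂,c_j) = 0, then OWA(X̂) ≤ γ·OWA(X); (ii) if α ∈ (0,1), then OWA(X̂) ≤ (γ/α)·OWA(X). -/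
/-- A convex combination of `M ≥ m` is at most `M`, hence at most `γ / α` times the combination
of any `M' ≥ M / γ` and `m' ≥ 0`. -/
theorem convex_comb_le_div_mul {α γ M m M' m' : ℝ} (hα0 : 0 < α) (hα1 : α ≤ 1) (hγ : 0 ≤ γ)
    (hm : m ≤ M) (hm' : 0 ≤ m') (hM : M ≤ γ * M') :
    α * M + (1 - α) * m ≤ (γ / α) * (α * M' + (1 - α) * m') := by
  have h1α : 0 ≤ 1 - α := sub_nonneg.2 hα1
  calc α * M + (1 - α) * m ≤ α * M + (1 - α) * M := by gcongr
    _ = M := by ring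
    _ ≤ γ * M' := hM
    _ = (γ / α) * (α * M') := by field_simp
    _ ≤ (γ / α) * (α * M' + (1 - α) * m') := by
      gcongr
      exact le_add_of_nonneg_right (mul_nonneg h1α hm')

/-- If the contribution of `m` vanishes, a bound on `M` transfers to the convex combination
without losing a factor. -/
theorem convex_comb_le_mul {α γ M m M' m' : ℝ} (hα0 : 0 ≤ α) (hα1 : α ≤ 1) (hγ : 0 ≤ γ)
    (hm' : 0 ≤ m') (hM : M ≤ γ * M') (h : α = 1 ∨ m = 0) :
    α * M + (1 - α) * m ≤ γ * (α * M' + (1 - α) * m') := by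
  have hzero : (1 - α) * m = 0 := by rcases h with rfl | rfl <;> simp
  have hnonneg : 0 ≤ γ * ((1 - α) * m') := mul_nonneg hγ (mul_nonneg (sub_nonneg.2 hα1) hm')
  linarith [mul_le_mul_of_nonneg_left hM hα0]

/-- If `Xhat ∈ Φ` is a `γ`-approximate solution of the min-max
problem (i.e. `max_j F(Xhat,c_j) ≤ γ · max_j F(X,c_j)` for every `X ∈ Φ`), then
for the Hurwicz criterion `OWA(Y) = α·max_j F(Y,c_j) + (1-α)·min_j F(Y,c_j)`
with `α ∈ (0,1]` and every `X ∈ Φ`: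
(i) if `α = 1` or `min_j F(Xhat,c_j) = 0` then `OWA(Xhat) ≤ γ·OWA(X)`;
(ii) if `α < 1` then `OWA(Xhat) ≤ (γ/α)·OWA(X)`. -/
theorem hurwicz_from_minmax_approx {n K : ℕ} (hK : 0 < K)
    (c : Fin n → Fin K → ℝ) (hc : ∀ i j, 0 ≤ c i j)
    (α : ℝ) (hα0 : 0 < α) (hα1 : α ≤ 1)
    (γ : ℝ) (hγ : 1 ≤ γ)
    (Φ : Set (Finset (Fin n)))
    (Xhat : Finset (Fin n)) (hXhatΦ : Xhat ∈ Φ)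
    (happrox : ∀ X ∈ Φ,
      Finset.univ.sup' ⟨⟨0, hK⟩, Finset.mem_univ _⟩ (fun j => ∑ i ∈ Xhat, c i j)
        ≤ γ * Finset.univ.sup' ⟨⟨0, hK⟩, Finset.mem_univ _⟩ (fun j => ∑ i ∈ X, c i j))
    (X : Finset (Fin n)) (hXΦ : X ∈ Φ) :
    ((α = 1 ∨ Finset.univ.inf' ⟨⟨0, hK⟩, Finset.mem_univ _⟩ (fun j => ∑ i ∈ Xhat, c i j) = 0) →
      α * Finset.univ.sup' ⟨⟨0, hK⟩, Finset.mem_univ _⟩ (fun j => ∑ i ∈ Xhat, c i j)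
        + (1 - α) * Finset.univ.inf' ⟨⟨0, hK⟩, Finset.mem_univ _⟩ (fun j => ∑ i ∈ Xhat, c i j)
      ≤ γ * (α * Finset.univ.sup' ⟨⟨0, hK⟩, Finset.mem_univ _⟩ (fun j => ∑ i ∈ X, c i j)
        + (1 - α) * Finset.univ.inf' ⟨⟨0, hK⟩, Finset.mem_univ _⟩ (fun j => ∑ i ∈ X, c i j)))
    ∧ (α < 1 →
      α * Finset.univ.sup' ⟨⟨0, hK⟩, Finset.mem_univ _⟩ (fun j => ∑ i ∈ Xhat, c i j)
        + (1 - α) * Finset.univ.inf' ⟨⟨0, hK⟩, Finset.mem_univ _⟩ (fun j => ∑ i ∈ Xhat, c i j)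
      ≤ (γ / α) * (α * Finset.univ.sup' ⟨⟨0, hK⟩, Finset.mem_univ _⟩ (fun j => ∑ i ∈ X, c i j)
        + (1 - α) * Finset.univ.inf' ⟨⟨0, hK⟩, Finset.mem_univ _⟩ (fun j => ∑ i ∈ X, c i j))) := by
  have hγ0 : 0 ≤ γ := zero_le_one.trans hγ
  have hmin : 0 ≤ Finset.univ.inf' ⟨⟨0, hK⟩, Finset.mem_univ _⟩ (fun j => ∑ i ∈ X, c i j) :=
    Finset.le_inf' _ _ fun j _ => Finset.sum_nonneg fun i _ => hc i j
  refine ⟨convex_comb_le_mul hα0.le hα1 hγ0 hmin (happrox X hXΦ), fun _ =>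
    convex_comb_le_div_mul hα0 hα1 hγ0 ?_ hmin (happrox X hXΦ)⟩
  exact (Finset.inf'_le _ (Finset.mem_univ ⟨0, hK⟩)).trans
    (Finset.le_sup' (fun j => ∑ i ∈ Xhat, c i j) (Finset.mem_univ ⟨0, hK⟩))
end
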